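/- arXiv:1910.04183 — 4 statements merged into one kernel-verified Lean document; each statement's English description precedes it below -/
import Mathlib

section
/- Let S be a finite set of items, let r : S → ℝ satisfy 0 ≤ r_i ≤ 1 for all i ∈ S, and let v, v̂ : S → ℝ be nonnegative. Then |R(S; v̂) − R(S; v)| ≤ (2 · ∑_{i∈S} |v̂_i − v_i|) / (1 + ∑_{i∈S} v_i). -/
/-- Lemma 4.2 (revenue perturbation): for a finite assortment `S` with revenues
`r i ∈ [0,1]` and nonnegative weights `v, vhat`, the expected revenues
`R(S; w) = (∑ r i * w i) / (1 + ∑ w i)` satisfy the stated perturbation bound. -/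
theorem revenue_perturbation {ι : Type*} (S : Finset ι) (r v vhat : ι → ℝ)
    (hr : ∀ i ∈ S, 0 ≤ r i ∧ r i ≤ 1)
    (hv : ∀ i ∈ S, 0 ≤ v i) (hvhat : ∀ i ∈ S, 0 ≤ vhat i) :
    |(∑ i ∈ S, r i * vhat i) / (1 + ∑ i ∈ S, vhat i)
        - (∑ i ∈ S, r i * v i) / (1 + ∑ i ∈ S, v i)|
      ≤ 2 * (∑ i ∈ S, |vhat i - v i|) / (1 + ∑ i ∈ S, v i) := by
  have hV : 0 ≤ ∑ i ∈ S, v i := Finset.sum_nonneg hv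
  have hVhat : 0 ≤ ∑ i ∈ S, vhat i := Finset.sum_nonneg hvhat
  have hA : 0 ≤ ∑ i ∈ S, r i * vhat i :=
    Finset.sum_nonneg fun i hi => mul_nonneg (hr i hi).1 (hvhat i hi)
  have hA_le : ∑ i ∈ S, r i * vhat i ≤ ∑ i ∈ S, vhat i :=
    Finset.sum_le_sum fun i hi => mul_le_of_le_one_left (hvhat i hi) (hr i hi).2
  have h_num : |∑ i ∈ S, r i * vhat i - ∑ i ∈ S, r i * v i| ≤ ∑ i ∈ S, |vhat i - v i| := by
    rw [← Finset.sum_sub_distrib]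
    refine (Finset.abs_sum_le_sum_abs _ _).trans (Finset.sum_le_sum fun i hi => ?_)
    rw [← mul_sub, abs_mul, abs_of_nonneg (hr i hi).1]
    exact mul_le_of_le_one_left (abs_nonneg _) (hr i hi).2
  have h_den : |∑ i ∈ S, v i - ∑ i ∈ S, vhat i| ≤ ∑ i ∈ S, |vhat i - v i| := by
    rw [abs_sub_comm, ← Finset.sum_sub_distrib]
    exact Finset.abs_sum_le_sum_abs _ _
  generalize ∑ i ∈ S, r i * vhat i = A at *
  generalize ∑ i ∈ S, r i * v i = B at *
  generalize ∑ i ∈ S, |vhat i - v i| = D at *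
  generalize ∑ i ∈ S, vhat i = W at *
  generalize ∑ i ∈ S, v i = V at *
  have hR : |A / (1 + W)| ≤ 1 := by
    rw [abs_of_nonneg (by positivity), div_le_one (by positivity)]
    linarith
  have h_eq : A / (1 + W) - B / (1 + V) = ((A - B) + A / (1 + W) * (V - W)) / (1 + V) := by
    field_simp
    ring
  rw [h_eq, abs_div, abs_of_pos (show 0 < 1 + V by positivity)]
  gcongr
  calc |(A - B) + A / (1 + W) * (V - W)|
      ≤ |A - B| + |A / (1 + W)| * |V - W| := by
        rw [← abs_mul]
        exact abs_add_le _ _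
    _ ≤ D + D :=
        add_le_add h_num ((mul_le_of_le_one_left (abs_nonneg _) hR).trans h_den)
    _ = 2 * D := by ring
end

section
/- Let K ≥ 1 be an integer, and let L > 0, T₀ > 0, N ≥ 1 be real parameters (L standing for ln T, T₀ for the epoch length, N for the number of active items). Let v ∈ [0,1], V ∈ [0, K], ε′ ∈ [0, 1/(4(K+2))], ε̃ ∈ [0, ε′], α₀, α₁ ∈ [−1, 1], and let η₀, η₁ be real numbers satisfying |η₀| ≤ 4L/(3T₀) + 2√(ε′L/(N T₀)) + 2√(L/((1+V) N T₀)), |η₁| ≤ 4L/(3T₀) + 2√(ε′L/(N T₀)) + 2√(v L/((1+V) N T₀)), max(|η₀|, |η₁|) ≤ √(8L/(N T₀)), and suppose (K+1)·√(8 N L / T₀) ≤ 1/4. Then the denominator 1 + (1+V)(ε̃ α₀ + η₀ N) is positive, and the estimate v̂ := (v + (1+V)(ε̃ α₁ + η₁ N)) / (1 + (1+V)(ε̃ α₀ + η₀ N)) satisfies |v̂ − v| ≤ 4(K+1) ε′ + 8(K+1) √(ε′ N L / T₀) + 16(K+1) N L / (3 T₀) + 8 √((1+V) v N L / T₀). 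-/
/-- A nonnegative factor may be moved inside a square root. -/
theorem mul_sqrt_eq_sqrt_of_sq_mul_eq {c z w : ℝ} (hc : 0 ≤ c) (h : c ^ 2 * z = w) :
    c * Real.sqrt z = Real.sqrt w := by
  rw [← h, Real.sqrt_mul (sq_nonneg c), Real.sqrt_sq hc]

/-- If `|x| ≤ 1 / 2`, the ratio `(v + y) / (1 + x)` is within `2 * |y - v * x|` of `v`. -/
theorem abs_add_div_one_add_sub_le {v x y : ℝ} (hx : |x| ≤ 1 / 2) :
    |(v + y) / (1 + x) - v| ≤ 2 * |y - v * x| := by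
  have hden : 1 / 2 ≤ 1 + x := by linarith [neg_abs_le x]
  have hpos : 0 < 1 + x := by linarith
  have heq : (v + y) / (1 + x) - v = (y - v * x) / (1 + x) := by
    field_simp
    ring
  rw [heq, abs_div, abs_of_pos hpos, div_le_iff₀ hpos]
  nlinarith [abs_nonneg (y - v * x)]

/-- The size of a contamination bias plus a scaled fluctuation. -/
theorem abs_mul_add_mul_le {p e a x N : ℝ} (hp : 0 ≤ p) (hpe : p ≤ e) (ha : |a| ≤ 1)
    (hN : 0 ≤ N) : |p * a + x * N| ≤ e + N * |x| := by
  calc |p * a + x * N| ≤ |p * a| + |x * N| := abs_add_le _ _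
    _ = p * |a| + N * |x| := by
        rw [abs_mul, abs_mul, abs_of_nonneg hp, abs_of_nonneg hN, mul_comm N]
    _ ≤ e + N * |x| := by
        have := mul_le_of_le_one_right hp ha
        linarith


/-- Deterministic core of Lemma 4.1: conditioned on the concentration events
(bounds on the fluctuations `e0, e1`), the preference-parameter estimate
deviates from the true parameter `v` by at most `Δ*`. -/
theorem estimation_error_bound (K : ℕ) (hK : 1 ≤ K)
    (L T0 N : ℝ) (hL : 0 < L) (hT0 : 0 < T0) (hN : 1 ≤ N)
    (v V eps' epst a0 a1 e0 e1 : ℝ)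
    (hv0 : 0 ≤ v) (hv1 : v ≤ 1)
    (hV0 : 0 ≤ V) (hVK : V ≤ (K : ℝ))
    (heps'0 : 0 ≤ eps') (heps'1 : eps' ≤ 1 / (4 * ((K : ℝ) + 2)))
    (hepst0 : 0 ≤ epst) (hepst1 : epst ≤ eps')
    (ha0 : a0 ∈ Set.Icc (-1 : ℝ) 1) (ha1 : a1 ∈ Set.Icc (-1 : ℝ) 1)
    (he0 : |e0| ≤ 4 * L / (3 * T0) + 2 * Real.sqrt (eps' * L / (N * T0))
        + 2 * Real.sqrt (L / ((1 + V) * N * T0)))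
    (he1 : |e1| ≤ 4 * L / (3 * T0) + 2 * Real.sqrt (eps' * L / (N * T0))
        + 2 * Real.sqrt (v * L / ((1 + V) * N * T0)))
    (hemax : max |e0| |e1| ≤ Real.sqrt (8 * L / (N * T0)))
    (hsmall : ((K : ℝ) + 1) * Real.sqrt (8 * N * L / T0) ≤ 1 / 4) :
    0 < 1 + (1 + V) * (epst * a0 + e0 * N) ∧
    |(v + (1 + V) * (epst * a1 + e1 * N)) / (1 + (1 + V) * (epst * a0 + e0 * N)) - v|
      ≤ 4 * ((K : ℝ) + 1) * eps' + 8 * ((K : ℝ) + 1) * Real.sqrt (eps' * N * L / T0)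
        + 16 * ((K : ℝ) + 1) * N * L / (3 * T0)
        + 8 * Real.sqrt ((1 + V) * v * N * L / T0) := by
  have hN0 : 0 < N := by linarith
  have hW : 0 < 1 + V := by linarith
  have hWK : 1 + V ≤ (K : ℝ) + 1 := by linarith
  have hK0 : (0 : ℝ) ≤ K := Nat.cast_nonneg K
  have hb0 := abs_mul_add_mul_le (x := e0) hepst0 hepst1 (abs_le.2 ha0) hN0.le
  have hb1 := abs_mul_add_mul_le (x := e1) hepst0 hepst1 (abs_le.2 ha1) hN0.le
  have hx : |(1 + V) * (epst * a0 + e0 * N)| ≤ 1 / 2 := by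
    have heps : ((K : ℝ) + 1) * eps' ≤ 1 / 4 := by
      rw [le_div_iff₀ (by positivity)] at heps'1
      nlinarith
    have hfluct : N * |e0| ≤ Real.sqrt (8 * N * L / T0) := by
      rw [← mul_sqrt_eq_sqrt_of_sq_mul_eq (z := 8 * L / (N * T0)) hN0.le (by field_simp)]
      exact mul_le_mul_of_nonneg_left ((le_max_left _ _).trans hemax) hN0.le
    rw [abs_mul, abs_of_pos hW]
    calc (1 + V) * |epst * a0 + e0 * N|
        ≤ ((K : ℝ) + 1) * (eps' + Real.sqrt (8 * N * L / T0)) := by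
          gcongr
          linarith
      _ ≤ 1 / 2 := by linarith
  refine ⟨by linarith [neg_abs_le ((1 + V) * (epst * a0 + e0 * N))],
    (abs_add_div_one_add_sub_le hx).trans ?_⟩
  have hsplit : |(1 + V) * (epst * a1 + e1 * N) - v * ((1 + V) * (epst * a0 + e0 * N))|
      ≤ (1 + V) * (eps' + N * |e1|) + v * ((1 + V) * (eps' + N * |e0|)) := by
    refine (abs_sub _ _).trans ?_
    rw [abs_mul, abs_mul v, abs_mul (1 + V), abs_of_pos hW, abs_of_nonneg hv0]
    gcongr
  set A := Real.sqrt (eps' * N * L / T0)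
  set B := Real.sqrt ((1 + V) * v * N * L / T0)
  have hsA : N * Real.sqrt (eps' * L / (N * T0)) = A :=
    mul_sqrt_eq_sqrt_of_sq_mul_eq hN0.le (by field_simp)
  have hsB : ((1 + V) * N) * Real.sqrt (v * L / ((1 + V) * N * T0)) = B :=
    mul_sqrt_eq_sqrt_of_sq_mul_eq (by positivity) (by field_simp)
  have hsC : v * (((1 + V) * N) * Real.sqrt (L / ((1 + V) * N * T0))) ≤ B := by
    rw [← mul_assoc, mul_sqrt_eq_sqrt_of_sq_mul_eq (w := v * ((1 + V) * v * N * L / T0))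
      (by positivity) (by field_simp)]
    exact Real.sqrt_le_sqrt (mul_le_of_le_one_left (by positivity) hv1)
  set D := eps' + 4 * (N * L) / (3 * T0) + 2 * A with hD
  have hD0 : 0 ≤ D := by positivity
  have h1 : (1 + V) * (eps' + N * |e1|) ≤ (1 + V) * D + 2 * B := by
    have := mul_le_mul_of_nonneg_left he1 (mul_pos hW hN0).le
    calc _ = (1 + V) * eps' + (1 + V) * N * |e1| := by ring
      _ ≤ _ := add_le_add_right this _
      _ = (1 + V) * D + 2 * B := by
        rw [hD, ← hsA, ← hsB]
        ring
  have h0 : v * ((1 + V) * (eps' + N * |e0|)) ≤ (1 + V) * D + 2 * B := by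
    have := mul_le_mul_of_nonneg_left he0 (mul_nonneg hv0 (mul_pos hW hN0).le)
    calc _ = v * (1 + V) * eps' + v * ((1 + V) * N) * |e0| := by ring
      _ ≤ _ := add_le_add_right this _
      _ = v * ((1 + V) * D)
          + 2 * (v * (((1 + V) * N) * Real.sqrt (L / ((1 + V) * N * T0)))) := by
        rw [hD, ← hsA]
        ring
      _ ≤ (1 + V) * D + 2 * B := by
        have := mul_le_of_le_one_left (mul_nonneg hW.le hD0) hv1
        linarith
  have hWD : (1 + V) * D ≤ ((K : ℝ) + 1) * D := mul_le_mul_of_nonneg_right hWK hD0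
  calc _ ≤ 4 * (((K : ℝ) + 1) * D) + 8 * B := by linarith
    _ = _ := by
      rw [hD]
      ring
end

section
/- Let K ≥ 1 be an integer and C ≥ 0, L ≥ 0 real numbers. Let S be a finite set with |S| ≤ K, let r : S → ℝ satisfy 0 ≤ r_i ≤ 1, let v, v̂ : S → ℝ be nonnegative, and set V := ∑_{i∈S} v_i. Suppose |v̂_i − v_i| ≤ C + 8 √((1 + V) · v_i · L) for every i ∈ S. Then |R(S; v̂) − R(S; v)| ≤ 2 K C + 16 √(K L). -/
/-- The ratios `(∑ rᵢ wᵢ) / (1 + ∑ wᵢ)` with `rᵢ ∈ [0, 1]` are Lipschitz in `w` for the `ℓ¹` norm,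
with constant `1 / (1 + ∑ vᵢ)` around `v`. -/
theorem abs_sum_mul_div_sub_le {ι : Type*} (S : Finset ι) (r v w : ι → ℝ)
    (hr : ∀ i ∈ S, 0 ≤ r i ∧ r i ≤ 1)
    (hv : ∀ i ∈ S, 0 ≤ v i) (hw : ∀ i ∈ S, 0 ≤ w i) :
    |(∑ i ∈ S, r i * w i) / (1 + ∑ i ∈ S, w i)
        - (∑ i ∈ S, r i * v i) / (1 + ∑ i ∈ S, v i)|
      ≤ (∑ i ∈ S, |w i - v i|) / (1 + ∑ i ∈ S, v i) := by
  have hV : 0 < 1 + ∑ i ∈ S, v i := by linarith [Finset.sum_nonneg hv]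
  have hW : 0 < 1 + ∑ i ∈ S, w i := by linarith [Finset.sum_nonneg hw]
  set ρ := (∑ i ∈ S, r i * w i) / (1 + ∑ i ∈ S, w i) with hρ
  have hρ_mul : ρ * (1 + ∑ i ∈ S, w i) = ∑ i ∈ S, r i * w i := div_mul_cancel₀ _ hW.ne'
  have hρ_nonneg : 0 ≤ ρ :=
    div_nonneg (Finset.sum_nonneg fun i hi => mul_nonneg (hr i hi).1 (hw i hi)) hW.le
  have hρ_le : ρ ≤ 1 := by
    rw [hρ, div_le_one hW]
    have : ∑ i ∈ S, r i * w i ≤ ∑ i ∈ S, w i :=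
      Finset.sum_le_sum fun i hi => mul_le_of_le_one_left (hw i hi) (hr i hi).2
    linarith
  have key : ρ - (∑ i ∈ S, r i * v i) / (1 + ∑ i ∈ S, v i)
      = (∑ i ∈ S, (r i - ρ) * (w i - v i)) / (1 + ∑ i ∈ S, v i) := by
    have hsum : ∑ i ∈ S, (r i - ρ) * (w i - v i)
        = ∑ i ∈ S, r i * w i - ∑ i ∈ S, r i * v i
          - ρ * (∑ i ∈ S, w i - ∑ i ∈ S, v i) := by
      simp only [sub_mul, mul_sub, Finset.sum_sub_distrib, Finset.mul_sum]
      ring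
    rw [hsum, sub_eq_iff_eq_add, ← add_div, eq_div_iff hV.ne']
    linear_combination hρ_mul
  rw [key, abs_div, abs_of_pos hV]
  gcongr
  refine (Finset.abs_sum_le_sum_abs _ _).trans (Finset.sum_le_sum fun i hi => ?_)
  rw [abs_mul]
  refine mul_le_of_le_one_left (abs_nonneg _) (abs_le.2 ⟨?_, ?_⟩) <;>
    linarith [(hr i hi).1, (hr i hi).2]

/-- A Cauchy–Schwarz bound on a sum of square roots. -/
theorem sum_sqrt_one_add_sum_mul_le {ι : Type*} {K L : ℝ} (hL : 0 ≤ L)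
    (S : Finset ι) (hS : (S.card : ℝ) ≤ K) (v : ι → ℝ) (hv : ∀ i ∈ S, 0 ≤ v i) :
    ∑ i ∈ S, Real.sqrt ((1 + ∑ j ∈ S, v j) * v i * L)
      ≤ (1 + ∑ j ∈ S, v j) * Real.sqrt (K * L) := by
  have hK : 0 ≤ K := (Nat.cast_nonneg _).trans hS
  have hV : 0 ≤ ∑ j ∈ S, v j := Finset.sum_nonneg hv
  set V := ∑ j ∈ S, v j with hVdef
  refine (sq_le_sq₀ (by positivity) (by positivity)).1 ?_
  calc (∑ i ∈ S, Real.sqrt ((1 + V) * v i * L)) ^ 2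
      ≤ S.card * ∑ i ∈ S, Real.sqrt ((1 + V) * v i * L) ^ 2 := sq_sum_le_card_mul_sum_sq
    _ = S.card * ((1 + V) * V * L) := by
        congr 1
        rw [hVdef, Finset.mul_sum, Finset.sum_mul]
        refine Finset.sum_congr rfl fun i hi => Real.sq_sqrt ?_
        have := hv i hi
        positivity
    _ ≤ K * ((1 + V) * (1 + V) * L) := by
        gcongr
        linarith
    _ = ((1 + V) * Real.sqrt (K * L)) ^ 2 := by
        rw [mul_pow, Real.sq_sqrt (by positivity)]
        ring


/-- Deterministic content of Corollary 4.1: per-item estimation-error bounds of the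
form `C + 8 √((1+V) v i L)` give a uniform confidence radius `2KC + 16 √(KL)` for
the expected revenue. -/
theorem revenue_confidence_radius {ι : Type*} (K : ℕ) (hK : 1 ≤ K)
    (C L : ℝ) (hC : 0 ≤ C) (hL : 0 ≤ L)
    (S : Finset ι) (hS : S.card ≤ K) (r v vhat : ι → ℝ)
    (hr : ∀ i ∈ S, 0 ≤ r i ∧ r i ≤ 1)
    (hv : ∀ i ∈ S, 0 ≤ v i) (hvhat : ∀ i ∈ S, 0 ≤ vhat i)
    (herr : ∀ i ∈ S, |vhat i - v i|
        ≤ C + 8 * Real.sqrt ((1 + ∑ j ∈ S, v j) * v i * L)) :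
    |(∑ i ∈ S, r i * vhat i) / (1 + ∑ i ∈ S, vhat i)
        - (∑ i ∈ S, r i * v i) / (1 + ∑ i ∈ S, v i)|
      ≤ 2 * (K : ℝ) * C + 16 * Real.sqrt ((K : ℝ) * L) := by
  have hV : 0 ≤ ∑ i ∈ S, v i := Finset.sum_nonneg hv
  have hS' : (S.card : ℝ) ≤ K := by exact_mod_cast hS
  refine (abs_sum_mul_div_sub_le S r v vhat hr hv hvhat).trans ?_
  rw [div_le_iff₀ (by linarith)]
  have hsqrt := sum_sqrt_one_add_sum_mul_le hL S hS' v hv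
  have hsum := Finset.sum_le_sum herr
  rw [Finset.sum_add_distrib, Finset.sum_const, nsmul_eq_mul, ← Finset.mul_sum] at hsum
  have hcard : (S.card : ℝ) * C ≤ K * C := by gcongr
  have hKC : 0 ≤ (K : ℝ) * C := by positivity
  have hroot : 0 ≤ (1 + ∑ i ∈ S, v i) * Real.sqrt ((K : ℝ) * L) := by positivity
  nlinarith [mul_nonneg hKC hV]
end

section
/- Let C be a nonempty finite set, 0 ≤ Δ_j ≤ Δ_k, and f_j, f_k, g : C → ℝ with |f_j(x) − g(x)| ≤ Δ_j and |f_k(x) − g(x)| ≤ Δ_k for all x ∈ C. Let x* ∈ C attain the maximum of g over C, and let x ∈ C satisfy f_j(x) ≥ (max_{y∈C} f_j(y)) − 2Δ_j. Then f_k(x) ≥ (max_{y∈C} f_k(y)) − 6Δ_k. -/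
/-- Abstract chain at the heart of Lemma 5.2: an element retained by the more
aggressive thread `j` remains within `6 Δk` of thread `k`'s optimistic value. -/
theorem cross_thread_consistency {ι : Type*} (C : Finset ι) (hne : C.Nonempty)
    (Δj Δk : ℝ) (hΔj : 0 ≤ Δj) (hjk : Δj ≤ Δk)
    (fj fk g : ι → ℝ)
    (hj : ∀ x ∈ C, |fj x - g x| ≤ Δj) (hk : ∀ x ∈ C, |fk x - g x| ≤ Δk)
    (xstar : ι) (hxs : xstar ∈ C) (hmax : ∀ x ∈ C, g x ≤ g xstar)
    (x : ι) (hxC : x ∈ C) (hf : fj x ≥ C.sup' hne fj - 2 * Δj) :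
    fk x ≥ C.sup' hne fk - 6 * Δk := by
  have hsup : C.sup' hne fk ≤ fk x + 6 * Δk := by
    refine Finset.sup'_le hne fk fun y hy => ?_
    have hstar : fj xstar ≤ C.sup' hne fj := Finset.le_sup' fj hxs
    have hgy := hmax y hy
    have hky := abs_le.mp (hk y hy)
    have hkx := abs_le.mp (hk x hxC)
    have hjx := abs_le.mp (hj x hxC)
    have hjs := abs_le.mp (hj xstar hxs)
    linarith [hky.2, hkx.1, hjx.2, hjs.1]
  linarith
end
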